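/- The RG-generating map is well-defined with respect to splitting the marginalisation and conditioning sets: for a ribbonless graph H = (N,F) and pairwise disjoint subsets C, C₁, M, M₁ of N, α_RG(α_RG(H;M,C);M₁,C₁) = α_RG(H;M∪M₁,C∪C₁). -/

import Mathlib

/-!
Stable mixed graphs: mixed graphs with arrows, arcs and lines; ribbonless,
summary and ancestral graphs; the generating maps α_RG, α_SG, α_AG;
m-connecting paths, m-separation and induced independence models.
-/

namespace StableMixedGraphs

/-- A mixed graph on node type `V`: a node set together with three edge
relations: arrows (`arrow i j` means an arrow from `i` to `j`), arcs
(two-headed, symmetric) and lines (undirected, symmetric). -/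
structure MixedGraph (V : Type) where
  nodes : Set V
  arrow : V → V → Prop
  arc : V → V → Prop
  line : V → V → Prop

namespace MixedGraph

variable {V W : Type}

/-- Wellformedness: arcs and lines are symmetric relations and all edges join
nodes of the graph. -/
def Wf (G : MixedGraph V) : Prop :=
  (∀ i j, G.arc i j → G.arc j i) ∧
  (∀ i j, G.line i j → G.line j i) ∧
  (∀ i j, G.arrow i j ∨ G.arc i j ∨ G.line i j → i ∈ G.nodes ∧ j ∈ G.nodes)

/-- No loops of any of the three kinds. -/
def Loopless (G : MixedGraph V) : Prop :=
  ∀ i, ¬ G.arrow i i ∧ ¬ G.arc i i ∧ ¬ G.line i i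

/-- A loopless mixed graph with a finite node set. -/
def IsLMG (G : MixedGraph V) : Prop := G.Wf ∧ G.Loopless ∧ G.nodes.Finite

/-- `G.anc i j` : `i` is an ancestor of `j`, i.e. there is a
direction-preserving path from `i` to `j`. -/
def anc (G : MixedGraph V) (i j : V) : Prop := Relation.TransGen G.arrow i j

/-- The set of ancestors of nodes of `C`. -/
def anSet (G : MixedGraph V) (C : Set V) : Set V := {a | ∃ c ∈ C, G.anc a c}

/-- `i` lies on a direction-preserving cycle. -/
def OnDPCycle (G : MixedGraph V) (i : V) : Prop := G.anc i i

/-- `i` is an endpoint of a line. -/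
def LineEndpoint (G : MixedGraph V) (i : V) : Prop := ∃ j, G.line i j

/-- Condition (2) of a ribbon: `i` or a descendant of `i` is an endpoint of a
line or lies on a direction-preserving cycle. -/
def RibbonTail (G : MixedGraph V) (i : V) : Prop :=
  ∃ d, (d = i ∨ G.anc i d) ∧ (G.LineEndpoint d ∨ G.OnDPCycle d)

/-- `G` contains a ribbon: a collider V-configuration `⟨h,i,j⟩` with no
endpoint-identical edge between `h` and `j`, whose inner node `i` (or a
descendant of it) is an endpoint of a line or on a direction-preserving
cycle. -/
def HasRibbon (G : MixedGraph V) : Prop :=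
  ∃ h i j, h ≠ i ∧ i ≠ j ∧ h ≠ j ∧ G.RibbonTail i ∧
    ((G.arc h i ∧ G.arc i j ∧ ¬ G.arc h j) ∨
     (G.arrow h i ∧ G.arrow j i ∧ ¬ G.line h j) ∨
     (G.arrow h i ∧ G.arc i j ∧ ¬ G.arrow h j))

/-- A ribbonless graph: a loopless mixed graph with no ribbon. -/
def IsRG (G : MixedGraph V) : Prop := G.IsLMG ∧ ¬ G.HasRibbon

/-- A directed acyclic graph: only arrows, no direction-preserving cycle. -/
def IsDAG (G : MixedGraph V) : Prop :=
  G.IsLMG ∧ (∀ i j, ¬ G.arc i j) ∧ (∀ i j, ¬ G.line i j) ∧ ∀ i, ¬ G.anc i i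

/-- A summary graph: a loopless mixed graph with no arrowhead pointing to an
endpoint of a line and no direction-preserving cycle. -/
def IsSG (G : MixedGraph V) : Prop :=
  G.IsLMG ∧ (∀ i, G.LineEndpoint i → ∀ k, ¬ G.arrow k i ∧ ¬ G.arc k i) ∧
    ∀ i, ¬ G.anc i i

/-- A simple mixed graph: no loops and no multiple edges. -/
def Simple (G : MixedGraph V) : Prop :=
  G.Loopless ∧ ∀ i j,
    (G.arrow i j → ¬ G.arrow j i ∧ ¬ G.arc i j ∧ ¬ G.line i j) ∧
    (G.arc i j → ¬ G.line i j)

/-- An ancestral graph: a simple mixed graph such that no node is an ancestor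
of one of its parents or spouses, and a node with a neighbour has neither
parents nor spouses. -/
def IsAG (G : MixedGraph V) : Prop :=
  G.Wf ∧ G.Simple ∧ G.nodes.Finite ∧
  (∀ i j, G.arrow j i ∨ G.arc j i → ¬ G.anc i j) ∧
  (∀ i, G.LineEndpoint i → ∀ k, ¬ G.arrow k i ∧ ¬ G.arc k i)

/-- An undirected graph: only lines. -/
def IsUG (G : MixedGraph V) : Prop :=
  G.IsLMG ∧ (∀ i j, ¬ G.arrow i j) ∧ ∀ i j, ¬ G.arc i j

/-- A bidirected graph: only arcs. -/
def IsBG (G : MixedGraph V) : Prop :=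
  G.IsLMG ∧ (∀ i j, ¬ G.arrow i j) ∧ ∀ i j, ¬ G.line i j

/-- Image of a mixed graph under a map of node types. -/
def map (f : V → W) (G : MixedGraph V) : MixedGraph W where
  nodes := f '' G.nodes
  arrow a b := ∃ i j, G.arrow i j ∧ f i = a ∧ f j = b
  arc a b := ∃ i j, G.arc i j ∧ f i = a ∧ f j = b
  line a b := ∃ i j, G.line i j ∧ f i = a ∧ f j = b

end MixedGraph

/-! ### The closure generating new edges (Table 1 of the RG-generating
algorithm), for given marginalisation set `M` and collider set
`S = C ∪ an(C)`.  For every V-configuration whose inner node is a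
non-collider in `M` (rows 1–7) or a collider in `S` (rows 8–10) the
endpoint-identical edge between the endpoints is generated, repeatedly
until closure. -/

mutual
  /-- Generated arrows (`GenArrow H M S j i`: arrow from `j` to `i`). -/
  inductive GenArrow {V : Type} (H : MixedGraph V) (M S : Set V) : V → V → Prop
    | base {i j : V} : H.arrow i j → GenArrow H M S i j
    | row1 {i j m : V} : m ∈ M → j ≠ i →
        GenArrow H M S j m → GenArrow H M S m i → GenArrow H M S j i
    | row2 {i j m : V} : m ∈ M → j ≠ i →
        GenLine H M S j m → GenArrow H M S m i → GenArrow H M S j i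
    | row3 {i j m : V} : m ∈ M → j ≠ i →
        GenLine H M S j m → GenArc H M S m i → GenArrow H M S j i
    | row8 {i j s : V} : s ∈ S → j ≠ i →
        GenArrow H M S j s → GenArc H M S s i → GenArrow H M S j i

  /-- Generated arcs. -/
  inductive GenArc {V : Type} (H : MixedGraph V) (M S : Set V) : V → V → Prop
    | base {i j : V} : H.arc i j → GenArc H M S i j
    | symm {i j : V} : GenArc H M S i j → GenArc H M S j i
    | row4 {i j m : V} : m ∈ M → i ≠ j →
        GenArrow H M S m i → GenArrow H M S m j → GenArc H M S i j
    | row5 {i j m : V} : m ∈ M → i ≠ j →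
        GenArrow H M S m i → GenArc H M S m j → GenArc H M S i j
    | row9 {i j s : V} : s ∈ S → i ≠ j →
        GenArc H M S i s → GenArc H M S s j → GenArc H M S i j

  /-- Generated lines. -/
  inductive GenLine {V : Type} (H : MixedGraph V) (M S : Set V) : V → V → Prop
    | base {i j : V} : H.line i j → GenLine H M S i j
    | symm {i j : V} : GenLine H M S i j → GenLine H M S j i
    | row6 {i j m : V} : m ∈ M → i ≠ j →
        GenLine H M S i m → GenArrow H M S j m → GenLine H M S i j
    | row7 {i j m : V} : m ∈ M → i ≠ j →
        GenLine H M S i m → GenLine H M S m j → GenLine H M S i j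
    | row10 {i j s : V} : s ∈ S → i ≠ j →
        GenArrow H M S i s → GenArrow H M S j s → GenLine H M S i j
end

variable {V : Type}

/-- The RG-generating map `α_RG(H;M,C)`: generate all edges of the closure
and delete the nodes of `M ∪ C`. -/
def alphaRG (H : MixedGraph V) (M C : Set V) : MixedGraph V where
  nodes := H.nodes \ (M ∪ C)
  arrow i j := i ∈ H.nodes \ (M ∪ C) ∧ j ∈ H.nodes \ (M ∪ C) ∧
    GenArrow H M (C ∪ H.anSet C) i j
  arc i j := i ∈ H.nodes \ (M ∪ C) ∧ j ∈ H.nodes \ (M ∪ C) ∧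
    GenArc H M (C ∪ H.anSet C) i j
  line i j := i ∈ H.nodes \ (M ∪ C) ∧ j ∈ H.nodes \ (M ∪ C) ∧
    GenLine H M (C ∪ H.anSet C) i j

/-- The arrowhead-removal operation `α_RG.SG(K;A)`: every arrowhead pointing
at a node of `A` is removed (an arrow at such a node becomes a line, an arc
becomes an arrow, an arc with both endpoints in `A` becomes a line),
repeatedly until closure. -/
def deheadAt (K : MixedGraph V) (A : Set V) : MixedGraph V where
  nodes := K.nodes
  arrow j i := i ∉ A ∧ (K.arrow j i ∨ (K.arc j i ∧ j ∈ A))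
  arc i j := K.arc i j ∧ i ∉ A ∧ j ∉ A
  line i j := K.line i j ∨ (K.arrow j i ∧ i ∈ A) ∨ (K.arrow i j ∧ j ∈ A) ∨
    (K.arc i j ∧ i ∈ A ∧ j ∈ A)

/-- The SG-generating map `α_SG(H;M,C)`: mark the nodes of `an(C)`, apply the
RG-generating construction, then remove all arrowheads pointing at marked
nodes. -/
def alphaSG (H : MixedGraph V) (M C : Set V) : MixedGraph V :=
  deheadAt (alphaRG H M C) (H.anSet C)

/-! ### Step 2 of the AG-generating algorithm: for every V-configuration
`j → k ↔ i` or `j ↔ k ↔ i` with `k ∈ an(i)` (in the current graph) generate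
an arrow from `j` to `i`, respectively an arc between `j` and `i`, until
closure. -/

mutual
  inductive AG2Arrow {V : Type} (K : MixedGraph V) : V → V → Prop
    | base {i j : V} : K.arrow j i → AG2Arrow K j i
    | gen {i j k : V} : j ≠ i → AG2Arrow K j k → AG2Arc K k i →
        AG2Anc K k i → AG2Arrow K j i

  inductive AG2Arc {V : Type} (K : MixedGraph V) : V → V → Prop
    | base {i j : V} : K.arc i j → AG2Arc K i j
    | symm {i j : V} : AG2Arc K i j → AG2Arc K j i
    | gen {i j k : V} : j ≠ i → AG2Arc K j k → AG2Arc K k i →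
        AG2Anc K k i → AG2Arc K j i

  /-- The ancestor relation of the graph being generated in step 2. -/
  inductive AG2Anc {V : Type} (K : MixedGraph V) : V → V → Prop
    | single {i j : V} : AG2Arrow K i j → AG2Anc K i j
    | tail {i k j : V} : AG2Arrow K i k → AG2Anc K k j → AG2Anc K i j
end

/-- The graph after step 2 of the AG-generating algorithm. -/
def ag2 (K : MixedGraph V) : MixedGraph V where
  nodes := K.nodes
  arrow := AG2Arrow K
  arc := AG2Arc K
  line := K.line

/-! ### Step 3 of the AG-generating algorithm: repeatedly replace every arc
between `j` and `i` with `j ∈ an(i)` (in the current graph) by an arrow from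
`j` to `i`. -/

mutual
  inductive AG3Arrow {V : Type} (K : MixedGraph V) : V → V → Prop
    | base {i j : V} : K.arrow j i → AG3Arrow K j i
    | conv {i j : V} : K.arc j i → AG3Anc K j i → AG3Arrow K j i

  /-- The ancestor relation of the graph being generated in step 3. -/
  inductive AG3Anc {V : Type} (K : MixedGraph V) : V → V → Prop
    | single {i j : V} : AG3Arrow K i j → AG3Anc K i j
    | tail {i k j : V} : AG3Arrow K i k → AG3Anc K k j → AG3Anc K i j
end

/-- Steps 2 and 3 of the AG-generating algorithm, applied to a summary
graph: `α_SG.AG`. -/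
def alphaSGAG (K : MixedGraph V) : MixedGraph V :=
  let K2 := ag2 K
  { nodes := K.nodes
    arrow := AG3Arrow K2
    arc := fun i j => K2.arc i j ∧ ¬ AG3Anc K2 i j ∧ ¬ AG3Anc K2 j i
    line := K.line }

/-- The AG-generating map `α_AG(H;M,C)`. -/
def alphaAG (H : MixedGraph V) (M C : Set V) : MixedGraph V :=
  alphaSGAG (alphaSG H M C)

/-! ### Paths, m-connection and m-separation. -/

/-- A step of a walk: it goes from `src` to `tgt` along an edge which has an
arrowhead at `src` iff `hs = true` and an arrowhead at `tgt` iff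
`ht = true` (so `hs = ht = false` is a line, `hs = ht = true` an arc, and
exactly one head an arrow in the corresponding direction). -/
structure Step (V : Type) where
  src : V
  tgt : V
  hs : Bool
  ht : Bool

/-- The edge of a step is present in `G`. -/
def Step.valid (G : MixedGraph V) (s : Step V) : Prop :=
  match s.hs, s.ht with
  | false, false => G.line s.src s.tgt
  | false, true  => G.arrow s.src s.tgt
  | true,  false => G.arrow s.tgt s.src
  | true,  true  => G.arc s.src s.tgt

/-- `w` is a path from `i` to `j` in `G`: a nonempty chained list of valid
steps with no repeated nodes. -/
def IsPath (G : MixedGraph V) (i j : V) (w : List (Step V)) : Prop :=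
  w ≠ [] ∧ (∀ s ∈ w, s.valid G) ∧ List.Chain' (fun a b => a.tgt = b.src) w ∧
    w.head?.map Step.src = some i ∧ w.getLast?.map Step.tgt = some j ∧
    (i :: w.map Step.tgt).Nodup

/-- The path `w` is m-connecting given `M` and `C`: every inner collider node
is in `C ∪ an(C)` and every inner non-collider node is in `M`. -/
def MConnPath (G : MixedGraph V) (M C : Set V) (w : List (Step V)) : Prop :=
  List.Chain'
    (fun a b =>
      (a.ht = true ∧ b.hs = true → a.tgt ∈ C ∪ G.anSet C) ∧
      (¬ (a.ht = true ∧ b.hs = true) → a.tgt ∈ M)) w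

/-- `A ⊥_m B | C` in `G` : there is no m-connecting path between `A` and `B`
given `C` (with `M` the remaining nodes). -/
def MSep (G : MixedGraph V) (A B C : Set V) : Prop :=
  ∀ i ∈ A, ∀ j ∈ B, ∀ w : List (Step V),
    IsPath G i j w → ¬ MConnPath G (G.nodes \ (A ∪ B ∪ C)) C w

/-- The independence model induced by `G` via m-separation: the set of
triples `⟨A,B|C⟩` of pairwise disjoint subsets of the nodes with
`A ⊥_m B | C`. -/
def Jm (G : MixedGraph V) : Set (Set V × Set V × Set V) :=
  {t | t.1 ⊆ G.nodes ∧ t.2.1 ⊆ G.nodes ∧ t.2.2 ⊆ G.nodes ∧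
    Disjoint t.1 t.2.1 ∧ Disjoint t.1 t.2.2 ∧ Disjoint t.2.1 t.2.2 ∧
    MSep G t.1 t.2.1 t.2.2}

/-- The independence model after marginalisation over `M` and conditioning on
`C` : `α(J;M,C)`. -/
def alphaIM (J : Set (Set V × Set V × Set V)) (M C : Set V) :
    Set (Set V × Set V × Set V) :=
  {t | (t.1, t.2.1, t.2.2 ∪ C) ∈ J ∧ (t.1 ∪ t.2.1 ∪ t.2.2) ∩ (M ∪ C) = ∅}

/-! ### Edge relations with marked ends -/

/-- An edge relation recording the marks of both ends: `E u a b v` means that there is an edge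
between `u` and `v` with an arrowhead at `u` iff `a = true` and an arrowhead at `v` iff
`b = true`. -/
abbrev EdgeRel (V : Type) : Type := V → Bool → Bool → V → Prop

/-- A V-configuration with inner node `v` and marks `e`, `f` at `v` may be passed: a collider has
to lie in `S`, a non-collider in `M`. -/
def Passes (M S : Set V) (e : Bool) (v : V) (f : Bool) : Prop :=
  if e && f then v ∈ S else v ∈ M

/-- The closure of an edge relation under generation of endpoint-identical edges. -/
inductive Gen (E : EdgeRel V) (M S : Set V) : EdgeRel V
  | base {u v : V} {a b : Bool} : E u a b v → Gen E M S u a b v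
  | step {u m v : V} {a e f b : Bool} : u ≠ v → Gen E M S u a e m → Gen E M S m f b v →
      Passes M S e m f → Gen E M S u a b v

/-- `Walk E M S x a v e`: there is a walk from `x` to `v` whose first mark at `x` is `a`, whose
last mark at `v` is `e`, and all of whose inner nodes may be passed. -/
inductive Walk (E : EdgeRel V) (M S : Set V) (x : V) (a : Bool) : V → Bool → Prop
  | single {v : V} {e : Bool} : E x a e v → Walk E M S x a v e
  | snoc {v w : V} {e f g : Bool} : Walk E M S x a v e → Passes M S e v f → E v f g w →
      Walk E M S x a w g

/-- Edges may be read from either end, and there are no loops. -/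
structure EdgeRel.Proper (E : EdgeRel V) : Prop where
  symm : ∀ {u a b v}, E u a b v → E v b a u
  ne : ∀ {u a b v}, E u a b v → u ≠ v

/-- Every collider V-configuration at `v` is bridged by an endpoint-identical edge. -/
def EdgeRel.Bridged (E : EdgeRel V) (v : V) : Prop :=
  ∀ ⦃u w h g⦄, u ≠ w → E u h true v → E v true g w → E u h g w

/-- The edge relation contains the endpoint-identical edge for every passable
V-configuration. -/
def EdgeRel.Closed (E : EdgeRel V) (M S : Set V) : Prop :=
  ∀ ⦃u a e m f b v⦄, u ≠ v → E u a e m → E m f b v → Passes M S e m f → E u a b v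

/-- Both arrows and the arc between `x` and `y` are present. -/
def EdgeRel.Tangled (E : EdgeRel V) (x y : V) : Prop :=
  E x false true y ∧ E x true true y ∧ E x true false y

/-- Restriction to the edges between nodes of `N`. -/
def EdgeRel.restrict (E : EdgeRel V) (N : Set V) : EdgeRel V :=
  fun u a b v => E u a b v ∧ u ∈ N ∧ v ∈ N

/-- Removal of all edges with an arrowhead at `x` or `y`. -/
def EdgeRel.behead (E : EdgeRel V) (x y : V) : EdgeRel V :=
  fun u a b v => E u a b v ∧ (u = x ∨ u = y → a = false) ∧ (v = x ∨ v = y → b = false)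

section Passes

variable {M S : Set V} {v : V} {e f : Bool}

@[simp] lemma passes_true_true : Passes M S true v true ↔ v ∈ S := Iff.rfl

@[simp] lemma passes_false_left : Passes M S false v f ↔ v ∈ M := Iff.rfl

@[simp] lemma passes_false_right : Passes M S e v false ↔ v ∈ M := by cases e <;> exact Iff.rfl

lemma Passes.mono {M' S' : Set V} (hM : M ⊆ M') (hS : S ⊆ S') (h : Passes M S e v f) :
    Passes M' S' e v f := by
  cases e <;> cases f <;> simp at h ⊢ <;> first | exact hM h | exact hS h

lemma Passes.symm (h : Passes M S e v f) : Passes M S f v e := by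
  cases e <;> cases f <;> simpa using h

lemma Passes.collider (h : Passes M S e v f) (hv : v ∉ M) : e = true ∧ f = true ∧ v ∈ S := by
  cases e <;> cases f <;> simp_all

end Passes

section Gen

variable {E E' : EdgeRel V} {M M' S S' : Set V} {u v x : V} {a b e : Bool}

lemma Gen.mono (hE : ∀ ⦃u a b v⦄, E u a b v → E' u a b v) (hM : M ⊆ M') (hS : S ⊆ S')
    (h : Gen E M S u a b v) : Gen E' M' S' u a b v := by
  induction h with
  | base h => exact .base (hE h)
  | step hne _ _ hp ih₁ ih₂ => exact .step hne ih₁ ih₂ (hp.mono hM hS)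

lemma Gen.closed (E : EdgeRel V) (M S : Set V) : EdgeRel.Closed (Gen E M S) M S :=
  fun _ _ _ _ _ _ _ hne h₁ h₂ hp => .step hne h₁ h₂ hp

lemma Gen.proper (hE : E.Proper) (M S : Set V) : EdgeRel.Proper (Gen E M S) where
  symm h := by
    induction h with
    | base h => exact .base (hE.symm h)
    | step hne _ _ hp ih₁ ih₂ => exact .step hne.symm ih₂ ih₁ hp.symm
  ne h := by
    cases h with
    | base h => exact hE.ne h
    | step hne => exact hne

lemma Gen.of_closed (hE : E.Closed M S) (h : Gen E M S u a b v) : E u a b v := by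
  induction h with
  | base h => exact h
  | step hne _ _ hp ih₁ ih₂ => exact hE hne ih₁ ih₂ hp

/-- Generation creates no arrowhead at a node without arrowheads. -/
lemma Gen.no_head (hE : ∀ ⦃a b v⦄, E x a b v → a = false) (h : Gen E M S u a b v) (hu : u = x) :
    a = false := by
  induction h with
  | base h => exact hE (hu ▸ h)
  | step _ _ _ _ ih₁ _ => exact ih₁ hu

lemma EdgeRel.Closed.bridged (hE : E.Closed M S) (hv : v ∈ S) : E.Bridged v :=
  fun _ _ _ _ hne h₁ h₂ => hE hne h₁ h₂ hv

lemma Walk.mono (hE : ∀ ⦃u a b v⦄, E u a b v → E' u a b v) (hM : M ⊆ M') (hS : S ⊆ S')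
    (h : Walk E M S x a v e) : Walk E' M' S' x a v e := by
  induction h with
  | single h => exact .single (hE h)
  | snoc _ hp h ih => exact .snoc ih (hp.mono hM hS) (hE h)

lemma Walk.append {p : V} {f g : Bool} (h₁ : Walk E M S x a p e) (hp : Passes M S e p f)
    (h₂ : Walk E M S p f v g) : Walk E M S x a v g := by
  induction h₂ with
  | single h => exact .snoc h₁ hp h
  | snoc _ hp' h ih => exact .snoc ih hp' h

lemma Gen.walk (h : Gen E M S u a b v) : Walk E M S u a v b := by
  induction h with
  | base h => exact .single h
  | step _ _ _ hp ih₁ ih₂ => exact ih₁.append hp ih₂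

/-- A generated edge is an original one or arises from a walk through a third node. -/
lemma Gen.base_or_walk (hE : E.Proper) (h : Gen E M S u a b v) :
    E u a b v ∨ ∃ p e f, p ≠ u ∧ p ≠ v ∧ Walk E M S u a p e ∧ Passes M S e p f ∧
      Walk E M S p f v b := by
  cases h with
  | base h => exact .inl h
  | step _ h₁ h₂ hp =>
    exact .inr ⟨_, _, _, ((Gen.proper hE M S).ne h₁).symm, (Gen.proper hE M S).ne h₂, h₁.walk, hp,
      h₂.walk⟩

end Gen

section Fold

variable {E : EdgeRel V} {M S : Set V} {x y v w : V} {a b e f g : Bool}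

/-- What is known in a closed edge relation about the end of a walk that starts at `x` with
mark `a` and arrives at `v` with mark `e`. The walk may have returned to `x` in between, which
accounts for the alternatives to a direct edge. -/
private inductive Arrival (E : EdgeRel V) (M S : Set V) (x : V) (a : Bool) : V → Bool → Prop
  | edge {v : V} {e e' : Bool} : E x a e' v → (e' = e ∨ (v ∈ M ∧ e' = false)) →
      Arrival E M S x a v e
  | restart : a = true → Arrival E M S x a x true
  | loop {t : V} {p q : Bool} : a = false → E x false p t → E t q true x → Passes M S p t q →
      Arrival E M S x a x true
  | stuck : Arrival E M S x a x false
  | reflected {v : V} {p q : Bool} : a = false → v ∈ M → x ∈ S → E x false p v → E v q true x →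
      Passes M S p v q → E v false true x → Arrival E M S x a v false
  | tangled {v : V} : a = false → v ∉ M → x ∈ S → v ∈ S → E.Tangled x v → Arrival E M S x a v false

private lemma Arrival.of_edge {e' : Bool} (hC : E.Closed M S)
    (h : E x a e' v) (hp : Passes M S e' v f) (h' : E v f g w) : Arrival E M S x a w g := by
  by_cases hw : x = w
  · subst hw
    cases g
    · exact .stuck
    · cases a
      · exact .loop rfl h h' hp
      · exact .restart rfl
  · exact .edge (hC hw h h' hp) (.inl rfl)

private lemma Arrival.step (hx : x ∉ M) (hE : E.Proper) (hC : E.Closed M S)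
    (h : Arrival E M S x a v e) (hp : Passes M S e v f) (h' : E v f g w) :
    Arrival E M S x a w g := by
  cases h with
  | edge h he =>
    refine .of_edge hC h ?_ h'
    rcases he with rfl | ⟨hv, rfl⟩
    · exact hp
    · exact hv
  | restart ha =>
    obtain ⟨-, rfl, -⟩ := hp.collider hx
    subst ha
    exact .edge h' (.inl rfl)
  | @loop t p q ha h₁ h₂ hq =>
    obtain ⟨-, rfl, hxS⟩ := hp.collider hx
    subst ha
    by_cases hw : t = w
    · subst hw
      by_cases htM : t ∈ M
      · cases p
        · exact .edge h₁ (.inr ⟨htM, rfl⟩)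
        · cases g
          · exact .reflected rfl htM hxS h₁ h₂ hq (hE.symm h')
          · exact .edge h₁ (.inl rfl)
      · obtain ⟨rfl, rfl, htS⟩ := hq.collider htM
        cases g
        · exact .tangled rfl htM hxS htS ⟨h₁, hE.symm h₂, h'⟩
        · exact .edge h₁ (.inl rfl)
    · exact .edge (hC (hE.ne h') h₁ (hC hw h₂ h' hxS) hq) (.inl rfl)
  | stuck => exact absurd hp hx
  | @reflected _ p q ha hv hxS h₁ h₂ hq h₃ =>
    subst ha
    cases f
    · exact .of_edge hC h₁ (by simpa using hv) h'
    · by_cases hw : x = w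
      · subst hw
        cases g
        · exact .stuck
        · exact .loop rfl h₁ h₂ hq
      · have h₄ : E x true g w := hC hw (hE.symm h₃) h' hv
        exact .edge (hC hw h₁ (hC (hE.ne h') h₂ h₄ hxS) hq) (.inl rfl)
  | tangled ha hv => exact absurd hp hv

/-- In a closed edge relation a walk yields the endpoint-identical edge, unless that edge is a line
and its endpoints are tangled. -/
lemma Walk.edge_or_tangled (hE : E.Proper) (hC : E.Closed M S) (hx : x ∉ M) (hy : y ∉ M)
    (hxy : x ≠ y) (h : Walk E M S x a y b) :
    E x a b y ∨ (a = false ∧ b = false ∧ x ∈ S ∧ y ∈ S ∧ E.Tangled x y) := by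
  have key : ∀ {v e}, Walk E M S x a v e → Arrival E M S x a v e := by
    intro v e h
    induction h with
    | single h => exact .edge h (.inl rfl)
    | snoc _ hp h ih => exact ih.step hx hE hC hp h
  cases key h with
  | edge h₀ he =>
    rcases he with rfl | ⟨hv, -⟩
    · exact .inl h₀
    · exact absurd hv hy
  | restart => exact absurd rfl hxy
  | loop => exact absurd rfl hxy
  | stuck => exact absurd rfl hxy
  | reflected _ hv => exact absurd hv hy
  | tangled ha _ hxS hyS ht => exact .inr ⟨ha, rfl, hxS, hyS, ht⟩

end Fold

section Prune

variable {K : EdgeRel V} {M S D : Set V} {x y v w : V} {a b e f g : Bool}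

/-- What remains of a walk from `x` that has passed colliders in `D`, once these are bridged. -/
private inductive Pruned (K : EdgeRel V) (M S D : Set V) (x : V) (a : Bool) : V → Bool → Prop
  | walk {v : V} {e e' : Bool} : Walk K M S x a v e' →
      (e' = e ∨ (v ∈ M ∧ (v ∈ S ∪ D ∨ e' = false))) → Pruned K M S D x a v e
  | restart : a = true → Pruned K M S D x a x true
  | loop {s : V} : a = false → s ∈ D → K x false true s → K s true true x →
      Pruned K M S D x a x true
  | stuck {v : V} : v ∉ M → Pruned K M S D x a v false

private lemma Pruned.of_walk (hK : K.Proper) (hanc : ∀ ⦃u v⦄, K u false true v → v ∈ D → u ∈ D)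
    (hbr : ∀ v ∈ D, K.Bridged v) (hx : x ∉ M) (hv : v ∈ D) (W : Walk K M S x a v true)
    (h : K v true g w) : Pruned K M S D x a w g := by
  cases W with
  | single h₀ =>
    by_cases hw : x = w
    · subst hw
      cases g
      · exact .stuck hx
      · cases a
        · exact .loop rfl hv h₀ h
        · exact .restart rfl
    · exact .walk (.single (hbr v hv hw h₀ h)) (.inl rfl)
  | @snoc u _ eu p _ W hp h₀ =>
    by_cases hw : u = w
    · subst hw
      by_cases hu : u ∈ M
      · cases eu
        · exact .walk W (.inr ⟨hu, .inr rfl⟩)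
        · cases g
          · exact .walk W (.inr ⟨hu, .inl (.inr (hanc (hK.symm h) hv))⟩)
          · exact .walk W (.inl rfl)
      · obtain ⟨rfl, -, -⟩ := hp.collider hu
        cases g
        · exact .stuck hu
        · exact .walk W (.inl rfl)
    · exact .walk (.snoc W hp (hbr v hv hw h₀ h)) (.inl rfl)

private lemma Pruned.step (hK : K.Proper) (hanc : ∀ ⦃u v⦄, K u false true v → v ∈ D → u ∈ D)
    (hbr : ∀ v ∈ D, K.Bridged v) (hx : x ∉ M) (h : Pruned K M S D x a v e)
    (hp : Passes M (S ∪ D) e v f) (h' : K v f g w) : Pruned K M S D x a w g := by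
  cases h with
  | @walk _ _ e' W he =>
    have : Passes M S e' v f ∨ (e' = true ∧ f = true ∧ v ∈ D) := by
      rcases he with rfl | ⟨hv, he⟩
      · cases e' <;> cases f <;> simpa using hp
      · cases e' <;> cases f <;> simp_all
    rcases this with hp | ⟨rfl, rfl, hv⟩
    · exact .walk (.snoc W hp h') (.inl rfl)
    · exact .of_walk hK hanc hbr hx hv W h'
  | restart ha =>
    obtain ⟨-, rfl, -⟩ := hp.collider hx
    subst ha
    exact .walk (.single h') (.inl rfl)
  | @loop s ha hs h₁ h₂ =>
    obtain ⟨-, rfl, -⟩ := hp.collider hx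
    subst ha
    by_cases hw : s = w
    · subst hw
      cases g
      · by_cases hsM : s ∈ M
        · exact .walk (.single h₁) (.inr ⟨hsM, .inl (.inr hs)⟩)
        · exact .stuck hsM
      · exact .walk (.single h₁) (.inl rfl)
    · exact .walk (.single (hbr s hs (hK.ne h') h₁ (hbr x (hanc h₁ hs) hw h₂ h'))) (.inl rfl)
  | stuck hv => exact absurd (by simpa using hp) hv

private lemma Walk.pruned (hK : K.Proper) (hanc : ∀ ⦃u v⦄, K u false true v → v ∈ D → u ∈ D)
    (hbr : ∀ v ∈ D, K.Bridged v) (hx : x ∉ M) (h : Walk K M (S ∪ D) x a v e) :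
    Pruned K M S D x a v e := by
  induction h with
  | single h => exact .walk (.single h) (.inl rfl)
  | snoc _ hp h ih => exact ih.step hK hanc hbr hx hp h

private lemma Walk.bridge_or_tangled (hK : K.Proper)
    (hanc : ∀ ⦃u v⦄, K u false true v → v ∈ D → u ∈ D) (hbr : ∀ v ∈ D, K.Bridged v)
    (hy : y ∉ M) (hxy : x ≠ y) (W : Walk K M S x a v e) :
    (e = true → v ∈ D → K v true false y →
      Walk K M S x a y false ∨ (a = false ∧ K.Tangled x y)) ∧
    (v = y → e = true → ∀ v' ∈ D, K y true true v' → K v' true false y →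
      Walk K M S x a y false ∨ (a = false ∧ K.Tangled x y)) := by
  induction W with
  | @single v e h =>
    refine ⟨?_, ?_⟩
    · rintro rfl hv h'
      exact .inl (.single (hbr v hv hxy h h'))
    · rintro rfl rfl v' hv' h₁ h₂
      have hvD : v ∈ D := hanc (hK.symm h₂) hv'
      by_cases hx : x = v'
      · subst hx
        cases a
        · exact .inr ⟨rfl, h, hK.symm h₁, h₂⟩
        · exact .inl (.single h₂)
      · exact .inl (.single (hbr v' hv' hxy (hbr v hvD hx h h₁) h₂))
  | @snoc u v e f g W hp h ih =>
    refine ⟨?_, ?_⟩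
    · rintro rfl hv h'
      by_cases hu : u = y
      · subst hu
        obtain ⟨rfl, rfl, -⟩ := hp.collider hy
        exact ih.2 rfl rfl v hv h h'
      · exact .inl (.snoc W hp (hbr v hv hu h h'))
    · rintro rfl rfl v' hv' h₁ h₂
      have hvD : v ∈ D := hanc (hK.symm h₂) hv'
      by_cases hu : u = v'
      · subst hu
        cases e
        · exact .inl (.snoc W (f := true) (by simpa using hp) h₂)
        · exact ih.1 rfl hv' h₂
      · exact .inl (.snoc W hp (hbr v' hv' (hK.ne h) (hbr v hvD hu h h₁) h₂))

/-- Colliders in an ancestrally closed set of bridged nodes can be avoided on walks between nodes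
outside `M` that are not tangled. -/
lemma Walk.prune (hK : K.Proper) (hanc : ∀ ⦃u v⦄, K u false true v → v ∈ D → u ∈ D)
    (hbr : ∀ v ∈ D, K.Bridged v) (hx : x ∉ M) (hy : y ∉ M) (hxy : x ≠ y)
    (h : Walk K M (S ∪ D) x a y b) :
    Walk K M S x a y b ∨ (a = false ∧ b = false ∧ K.Tangled x y) := by
  cases b
  · cases h with
    | single h => exact .inl (.single h)
    | @snoc v _ e f _ W hp h =>
      cases W.pruned hK hanc hbr hx with
      | @walk _ _ e' W he =>
        have : Passes M S e' v f ∨ (e' = true ∧ f = true ∧ v ∈ D) := by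
          rcases he with rfl | ⟨hv, he⟩
          · cases e' <;> cases f <;> simpa using hp
          · cases e' <;> cases f <;> simp_all
        rcases this with hp | ⟨rfl, rfl, hv⟩
        · exact .inl (.snoc W hp h)
        · rcases (W.bridge_or_tangled hK hanc hbr hy hxy).1 rfl hv h with h | ⟨ha, h⟩
          · exact .inl h
          · exact .inr ⟨ha, rfl, h⟩
      | restart ha =>
        obtain ⟨-, rfl, -⟩ := hp.collider hx
        subst ha
        exact .inl (.single h)
      | @loop s ha hs h₁ h₂ =>
        obtain ⟨-, rfl, -⟩ := hp.collider hx
        subst ha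
        by_cases hy : s = y
        · subst hy
          exact .inr ⟨rfl, rfl, h₁, hK.symm h₂, h⟩
        · exact .inl (.single (hbr s hs hxy h₁ (hbr x (hanc h₁ hs) hy h₂ h)))
      | stuck hv => exact absurd (by simpa using hp) hv
  · cases h.pruned hK hanc hbr hx with
    | walk W he =>
      rcases he with rfl | ⟨hv, -⟩
      · exact .inl W
      · exact absurd hv hy
    | restart => exact absurd rfl hxy
    | loop => exact absurd rfl hxy

end Prune

section Detach

variable {K : EdgeRel V} {M S : Set V} {x y t p v w : V} {e f g : Bool} {P : V → Bool → Prop}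

private lemma EdgeRel.Tangled.step (hbx : K.Bridged x) (hby : K.Bridged y) (hxy : K.Tangled x y)
    (hK : K.Proper)
    (hP : ∀ ⦃t e f g w⦄, P t e → t ≠ x → t ≠ y → Passes M S e t f → K t f g w → w ≠ x → w ≠ y →
      P w g)
    (htx : t ≠ x) (hty : t ≠ y) (ht : P t e) (hp : Passes M S e t f) (h : K t f g w) :
    (∃ t e f, t ≠ x ∧ t ≠ y ∧ P t e ∧ Passes M S e t f ∧ K t f false y) ∨
      (w ≠ x ∧ w ≠ y ∧ P w g) ∨ (w = x ∧ g = false) := by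
  by_cases hwx : w = x
  · subst hwx
    cases g
    · exact .inr (.inr ⟨rfl, rfl⟩)
    · exact .inl ⟨t, e, f, htx, hty, ht, hp, hbx hty h hxy.2.2⟩
  by_cases hwy : w = y
  · subst hwy
    cases g
    · exact .inl ⟨t, e, f, htx, hty, ht, hp, h⟩
    · exact .inl ⟨t, e, f, htx, hty, ht, hp, hbx hty (hby htx h (hK.symm hxy.2.1)) hxy.2.2⟩
  exact .inr (.inl ⟨hwx, hwy, hP ht htx hty hp h hwx hwy⟩)

/-- If `x` and `y` are tangled, bridged nodes and some walk from `x` to `y` with tails at both ends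
meets a third node, then there is such a walk whose inner nodes avoid `x` and `y`. The
predicate `P` expresses reachability from `x` by walks avoiding `x` and `y`. -/
private lemma EdgeRel.Tangled.exists_last_step (hK : K.Proper) (hbx : K.Bridged x)
    (hby : K.Bridged y) (hxy : K.Tangled x y) (hx : x ∉ M) (hy : y ∉ M)
    (hP₀ : ∀ ⦃t e⦄, t ≠ x → t ≠ y → K x false e t → P t e)
    (hP : ∀ ⦃t e f g w⦄, P t e → t ≠ x → t ≠ y → Passes M S e t f → K t f g w → w ≠ x → w ≠ y →
      P w g)
    (W₁ : Walk K M S x false p e) (hpx : p ≠ x) (hpy : p ≠ y) (hp : Passes M S e p f)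
    (W₂ : Walk K M S p f y false) :
    ∃ t e f, t ≠ x ∧ t ≠ y ∧ P t e ∧ Passes M S e t f ∧ K t f false y := by
  have reach : ∀ {v e}, Walk K M S x false v e →
      (∃ t e f, t ≠ x ∧ t ≠ y ∧ P t e ∧ Passes M S e t f ∧ K t f false y) ∨ v = x ∨ v = y ∨
        (v ≠ x ∧ v ≠ y ∧ P v e) := by
    intro v e W
    have fresh : ∀ {w g}, K x false g w → w = x ∨ w = y ∨ (w ≠ x ∧ w ≠ y ∧ P w g) := by
      intro w g h
      by_cases hwx : w = x
      · exact .inl hwx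
      by_cases hwy : w = y
      · exact .inr (.inl hwy)
      exact .inr (.inr ⟨hwx, hwy, hP₀ hwx hwy h⟩)
    induction W with
    | single h => exact .inr (fresh h)
    | @snoc v w e f g _ hp h ih =>
      by_cases hw : w = x ∨ w = y
      · rcases hw with hw | hw <;> simp [hw]
      push Not at hw
      rcases ih with h₀ | rfl | rfl | ⟨hvx, hvy, hv⟩
      · exact .inl h₀
      · obtain ⟨-, rfl, -⟩ := hp.collider hx
        exact .inr (fresh (hby hw.1.symm hxy.1 (hbx hw.2.symm (hK.symm hxy.2.1) h)))
      · obtain ⟨-, rfl, -⟩ := hp.collider hy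
        exact .inr (fresh (hby hw.1.symm hxy.1 h))
      · rcases hxy.step hbx hby hK hP hvx hvy hv hp h with h | h | h
        · exact .inl h
        · exact .inr (.inr (.inr h))
        · exact absurd h.1 hw.1
  rcases reach W₁ with h | h | h | ⟨-, -, hPp⟩
  · exact h
  · exact absurd h hpx
  · exact absurd h hpy
  have reach' : ∀ {v g}, Walk K M S p f v g →
      (∃ t e f, t ≠ x ∧ t ≠ y ∧ P t e ∧ Passes M S e t f ∧ K t f false y) ∨
        (v ≠ x ∧ v ≠ y ∧ P v g) ∨ (v = x ∧ g = false) := by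
    intro v g W
    induction W with
    | single h => exact hxy.step hbx hby hK hP hpx hpy hPp hp h
    | snoc _ hp h ih =>
      rcases ih with h₀ | ⟨hvx, hvy, hv⟩ | ⟨rfl, rfl⟩
      · exact .inl h₀
      · exact hxy.step hbx hby hK hP hvx hvy hv hp h
      · exact absurd hp hx
  rcases reach' W₂ with h | ⟨-, h, -⟩ | ⟨rfl, -⟩
  · exact h
  · exact absurd rfl h
  · exact absurd hxy.1 fun h => hK.ne h rfl

end Detach

section Transfer

variable {K : EdgeRel V} {M S M' S' N : Set V} {x y u v : V} {a b : Bool}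

lemma EdgeRel.Proper.restrict (hK : K.Proper) (N : Set V) : (K.restrict N).Proper where
  symm h := ⟨hK.symm h.1, h.2.2, h.2.1⟩
  ne h := hK.ne h.1

lemma EdgeRel.Proper.behead (hK : K.Proper) (x y : V) : (K.behead x y).Proper where
  symm h := ⟨hK.symm h.1, h.2.2, h.2.1⟩
  ne h := hK.ne h.1

private lemma Gen.transfer_of_tangled (hK : K.Proper) (hbx : K.Bridged x) (hby : K.Bridged y)
    (ht : K.Tangled x y) (hxy : x ≠ y) (hx : x ∉ M) (hy : y ∉ M) (hx' : x ∉ M') (hy' : y ∉ M')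
    (hxN : x ∈ N) (hyN : y ∈ N)
    (hconv : Walk (K.behead x y) M S x false y false →
      Walk ((K.behead x y).restrict N) M' S' x false y false)
    (h : Gen K M S x false false y) : Gen (K.restrict N) M' S' x false false y := by
  rcases h.base_or_walk hK with h | ⟨p, e, f, hpx, hpy, W₁, hp, W₂⟩
  · exact .base ⟨h, hxN, hyN⟩
  obtain ⟨t, e, f, htx, hty, W, hp, h⟩ := ht.exists_last_step
    (P := fun t e => Walk (K.behead x y) M S x false t e) hK hbx hby hx hy
    (fun t e htx hty h => .single ⟨h, fun _ => rfl, fun h => by tauto⟩)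
    (fun t e f w g W htx hty hp h hwx hwy => .snoc W hp
      ⟨h, fun h => by tauto, fun h => by tauto⟩) W₁ hpx hpy hp W₂
  have W' := hconv (.snoc W hp ⟨h, fun h => by tauto, fun _ => rfl⟩)
  have hP := (hK.behead x y).restrict N
  rcases Walk.edge_or_tangled (Gen.proper hP M' S') (Gen.closed _ _ _) hx' hy' hxy
    (W'.mono (fun _ _ _ _ => .base) le_rfl le_rfl) with h | ⟨-, -, -, -, h⟩
  · exact h.mono (fun _ _ _ _ h => ⟨h.1.1, h.2⟩) le_rfl le_rfl
  · exact absurd (Gen.no_head (fun _ _ _ h => h.1.2.1 (.inl rfl)) h.2.2 rfl) (by simp)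

/-- If walks can be converted to walks in a restriction, then so can generated edges. -/
private lemma Gen.transfer (hK : K.Proper) (hxy : x ≠ y)
    (hx : x ∉ M) (hy : y ∉ M) (hx' : x ∉ M') (hy' : y ∉ M') (hxN : x ∈ N) (hyN : y ∈ N)
    (hconv : ∀ a b, Walk K M S x a y b → Walk (K.restrict N) M' S' x a y b ∨
      (a = false ∧ b = false ∧ K.Tangled x y))
    (htangled : K.Tangled x y → K.Bridged x ∧ K.Bridged y ∧
      (Walk (K.behead x y) M S x false y false →
        Walk ((K.behead x y).restrict N) M' S' x false y false))
    (h : Gen K M S x a b y) : Gen (K.restrict N) M' S' x a b y := by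
  have hG := Gen.proper (hK.restrict N) M' S'
  have hC := Gen.closed (K.restrict N) M' S'
  rcases hconv a b h.walk with W | ⟨rfl, rfl, ht⟩
  · rcases Walk.edge_or_tangled hG hC hx' hy' hxy
      (W.mono (fun _ _ _ _ => .base) le_rfl le_rfl) with h₀ | ⟨rfl, rfl, hxS, hyS, ht⟩
    · exact h₀
    have lift : ∀ {u a v b}, Walk (K.restrict N) M' S' u a v b →
        Walk (Gen (K.restrict N) M' S') M' S' u a v b :=
      fun W => W.mono (fun _ _ _ _ => .base) le_rfl le_rfl
    have third : (∃ p e f, p ≠ x ∧ p ≠ y ∧ Walk (Gen (K.restrict N) M' S') M' S' x false p e ∧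
        Passes M' S' e p f ∧ Walk (Gen (K.restrict N) M' S') M' S' p f y false) →
        Gen (K.restrict N) M' S' x false false y := by
      rintro ⟨p, e, f, hpx, hpy, W₁, hp, W₂⟩
      obtain ⟨t, e, f, htx, hty, h₁, hp, h₂⟩ := ht.exists_last_step
        (P := fun t e => Gen (K.restrict N) M' S' x false e t) hG (hC.bridged hxS)
        (hC.bridged hyS) hx' hy' (fun _ _ _ _ h => h)
        (fun t e f w g h₁ _ _ hp h₂ hwx _ => hC hwx.symm h₁ h₂ hp) W₁ hpx hpy hp W₂
      exact hC hxy h₁ h₂ hp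
    obtain ⟨h₁, h₂, h₃⟩ := ht
    rcases h₁.base_or_walk (hK.restrict N) with h₁' | ⟨p, e, f, hpx, hpy, W₁, hp, W₂⟩
    · rcases (hG.symm h₂).base_or_walk (hK.restrict N) with
        h₂' | ⟨p, e, f, hpy, hpx, W₁, hp, W₂⟩
      · rcases h₃.base_or_walk (hK.restrict N) with h₃' | ⟨p, e, f, hpx, hpy, W₁, hp, W₂⟩
        · have ht : K.Tangled x y := ⟨h₁'.1, hK.symm h₂'.1, h₃'.1⟩
          obtain ⟨hbx, hby, hconv'⟩ := htangled ht
          exact Gen.transfer_of_tangled hK hbx hby ht hxy hx hy hx' hy' hxN hyN hconv' h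
        · exact third ⟨p, e, f, hpx, hpy,
            ((Walk.single h₁).snoc (f := true) hyS (hG.symm h₂)).append (f := true) hxS (lift W₁),
            hp, lift W₂⟩
      · exact third ⟨p, e, f, hpx, hpy, (Walk.single h₁).append (f := true) hyS (lift W₁), hp,
          (lift W₂).snoc (f := true) hxS h₃⟩
    · exact third ⟨p, e, f, hpx, hpy, lift W₁, hp,
        ((lift W₂).snoc (f := true) hyS (hG.symm h₂)).snoc (f := true) hxS h₃⟩
  · obtain ⟨hbx, hby, hconv'⟩ := htangled ht
    exact Gen.transfer_of_tangled hK hbx hby ht hxy hx hy hx' hy' hxN hyN hconv' h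

/-- Colliders in an ancestrally closed set of bridged nodes generate no edges between nodes
outside `M`. -/
lemma Gen.prune {D : Set V} (hK : K.Proper) (hanc : ∀ ⦃u v⦄, K u false true v → v ∈ D → u ∈ D)
    (hbr : ∀ v ∈ D, K.Bridged v) (hcyc : ∀ ⦃u v⦄, K u false true v → K u true false v → u ∈ D)
    (hx : x ∉ M) (hy : y ∉ M) (h : Gen K M (S ∪ D) x a b y) : Gen K M S x a b y := by
  have hxy := (Gen.proper hK M _).ne h
  have hu : ∀ K' : EdgeRel V, K'.restrict Set.univ = K' := fun K' => by
    funext u a b v; simp [EdgeRel.restrict]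
  have := Gen.transfer (N := Set.univ) hK hxy hx hy hx hy trivial trivial (M' := M) (S' := S)
    (fun a b W => by simpa only [hu] using W.prune hK hanc hbr hx hy hxy) ?_ h
  · simpa only [hu] using this
  · rintro ⟨h₁, h₂, h₃⟩
    refine ⟨hbr x (hcyc h₁ h₃), hbr y (hcyc (hK.symm h₃) (hK.symm h₁)), fun W => ?_⟩
    rw [hu]
    rcases W.prune (D := D) (hK.behead x y) (fun u v h hv => hanc h.1 hv)
      (fun v hv u w h g hne h₁ h₂ => ⟨hbr v hv hne h₁.1 h₂.1, h₁.2.1, h₂.2.2⟩) hx hy hxy with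
      h | ⟨-, -, h⟩
    · exact h
    · exact absurd (h.2.1.2.1 (.inl rfl)) (by simp)

end Transfer

section Splitting

variable {K : EdgeRel V} {M D N M₁ D₁ T : Set V} {le : V → V → Prop} {u v w x y : V}
  {a b e f g h : Bool}

/-- `D` is closed under the relation `le` and contains all cycles of `le`, and a tail at `u` on an
edge of `K` witnesses that `u ∈ D` or that the edge is an arrow along `le`. -/
structure EdgeRel.Anterior (K : EdgeRel V) (D : Set V) (le : V → V → Prop) : Prop where
  proper : K.Proper
  trans : ∀ ⦃u v w⦄, le u v → le v w → le u w
  mem_of_le : ∀ ⦃u v⦄, le u v → v ∈ D → u ∈ D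
  mem_of_cycle : ∀ ⦃u⦄, le u u → u ∈ D
  tail : ∀ ⦃u v b⦄, K u false b v → u ∈ D ∨ (b = true ∧ le u v)

namespace EdgeRel.Anterior

lemma mem_of_arrow (hK : K.Anterior D le) (h : K u false true v) (hv : v ∈ D) : u ∈ D :=
  (hK.tail h).elim id fun h => hK.mem_of_le h.2 hv

lemma mem_of_arrows (hK : K.Anterior D le) (h₁ : K u false true v) (h₂ : K u true false v) :
    u ∈ D := by
  rcases hK.tail h₁ with hu | ⟨-, hl⟩
  · exact hu
  rcases hK.tail (hK.proper.symm h₂) with hv | ⟨-, hl'⟩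
  · exact hK.mem_of_le hl hv
  · exact hK.mem_of_cycle (hK.trans hl hl')

lemma mem_or_le_of_walk (hK : K.Anterior D le) (W : Walk K M D u false v e) :
    u ∈ D ∨ (e = true ∧ le u v) := by
  induction W with
  | single h => exact hK.tail h
  | @snoc v w e f g _ hp h ih =>
    rcases ih with hu | ⟨rfl, hl⟩
    · exact .inl hu
    cases f
    · rcases hK.tail h with hv | ⟨hg, hl'⟩
      · exact .inl (hK.mem_of_le hl hv)
      · exact .inr ⟨hg, hK.trans hl hl'⟩
    · exact .inl (hK.mem_of_le hl hp)

lemma mem_or_le_of_walk_end (hK : K.Anterior D le) (W : Walk K M D u a v e) (he : e = false) :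
    v ∈ D ∨ (a = true ∧ le v u) := by
  induction W with
  | single h => exact hK.tail (hK.proper.symm (he ▸ h))
  | @snoc v w e f g _ hp h ih =>
    subst he
    rcases hK.tail (hK.proper.symm h) with hw | ⟨rfl, hl⟩
    · exact .inl hw
    cases e
    · rcases ih rfl with hv | ⟨ha, hl'⟩
      · exact .inl (hK.mem_of_le hl hv)
      · exact .inr ⟨ha, hK.trans hl hl'⟩
    · exact .inl (hK.mem_of_le hl hp)

lemma mono {K' : EdgeRel V} (hK : K.Anterior D le) (hK' : K'.Proper)
    (h : ∀ ⦃u a b v⦄, K' u a b v → K u a b v) : K'.Anterior D le where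
  proper := hK'
  trans := hK.trans
  mem_of_le := hK.mem_of_le
  mem_of_cycle := hK.mem_of_cycle
  tail _ _ _ h' := hK.tail (h h')

lemma gen (hK : K.Anterior D le) (M : Set V) : EdgeRel.Anterior (Gen K M D) D le where
  proper := Gen.proper hK.proper M D
  trans := hK.trans
  mem_of_le := hK.mem_of_le
  mem_of_cycle := hK.mem_of_cycle
  tail _ _ _ h := hK.mem_or_le_of_walk h.walk

end EdgeRel.Anterior

/-- The conditions under which generation from `K` with sets `M ∪ M₁` and `T` can be replaced
by generation from the restriction of `K` to `N` with sets `M₁` and `D₁`. -/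
structure EdgeRel.Splitting (K : EdgeRel V) (M D N M₁ D₁ T : Set V) (le : V → V → Prop) : Prop
    extends K.Anterior D le where
  closed : K.Closed M D
  notMem_of_mem : ∀ ⦃v⦄, v ∈ N → v ∉ M
  subset_nodes : M₁ ⊆ N
  subset : D ⊆ D₁
  inter_subset : T ∩ N ⊆ D₁
  detour : ∀ ⦃v⦄, v ∈ T → v ∉ D → v ∉ N →
    v ∈ M ∧ ∃ u ∈ N, u ∈ D₁ ∧ u ∉ D ∧ K v false true u

namespace EdgeRel.Splitting

lemma walk_restrict (hS : K.Splitting M D N M₁ D₁ T le) (hu : u ∈ N) (hv : v ∈ N) (huv : u ≠ v)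
    (W : Walk K M D u h v e) : Walk (K.restrict N) M₁ D₁ u h v e := by
  rcases W.edge_or_tangled hS.proper hS.closed (hS.notMem_of_mem hu) (hS.notMem_of_mem hv) huv with
    h | ⟨rfl, rfl, huD, hvD, h₁, h₂, h₃⟩
  · exact .single ⟨h, hu, hv⟩
  · have W₁ : Walk (K.restrict N) M₁ D₁ u false v true := .single ⟨h₁, hu, hv⟩
    have W₂ : Walk (K.restrict N) M₁ D₁ u false u true :=
      W₁.snoc (f := true) (hS.subset hvD) ⟨hS.proper.symm h₂, hv, hu⟩
    exact W₂.snoc (f := true) (hS.subset huD) ⟨h₃, hu, hv⟩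

/-- The start of a walk in the restriction, up to a departure from `u` with mark `h`. -/
private def Departs (K : EdgeRel V) (D N M₁ D₁ : Set V) (x : V) (a : Bool) (u : V) (h : Bool) :
    Prop :=
  (u = x ∧ h = a) ∨ ∃ e, Walk (K.restrict N) M₁ D₁ x a u e ∧ Passes M₁ D₁ e u h ∧ (u ∈ M₁ ∨ u ∉ D)

/-- A walk that leaves the restriction only in its last segment. -/
private def Segmented (K : EdgeRel V) (M D N M₁ D₁ : Set V) (x : V) (a : Bool) (v : V) (e : Bool) :
    Prop :=
  ∃ u h, u ∈ N ∧ Departs K D N M₁ D₁ x a u h ∧ Walk K M D u h v e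

private lemma Segmented.land (hS : K.Splitting M D N M₁ D₁ T le) (hx : x ∉ M₁)
    (hs : Segmented K M D N M₁ D₁ x a v e) (hv : v ∈ N) (hp : Passes M₁ D₁ e v f)
    (hvD : v ∈ M₁ ∨ v ∉ D) : Departs K D N M₁ D₁ x a v f := by
  obtain ⟨u, h, hu, hpre, W⟩ := hs
  by_cases huv : u = v
  · subst huv
    rcases hpre with ⟨rfl, rfl⟩ | ⟨e₁, W₁, hp₁, -⟩
    · obtain ⟨rfl, rfl, -⟩ := hp.collider hx
      cases h
      · rcases hS.mem_or_le_of_walk W with hD | ⟨-, hl⟩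
        · simp_all
        · have := hS.mem_of_cycle hl
          simp_all
      · exact .inl ⟨rfl, rfl⟩
    · refine .inr ⟨e₁, W₁, ?_, hvD⟩
      cases e₁
      · simpa using hp₁
      cases f
      · simpa using hp
      cases h
      · rcases hS.mem_or_le_of_walk W with hD | ⟨-, hl⟩
        · exact hS.subset hD
        · exact hS.subset (hS.mem_of_cycle hl)
      · exact hp₁
  · have W' := hS.walk_restrict hu hv huv W
    rcases hpre with ⟨rfl, rfl⟩ | ⟨e₁, W₁, hp₁, -⟩
    · exact .inr ⟨e, W', hp, hvD⟩
    · exact .inr ⟨e, W₁.append hp₁ W', hp, hvD⟩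

private lemma Segmented.snoc (hS : K.Splitting M D N M₁ D₁ T le) (hx : x ∉ M₁)
    (hs : Segmented K M D N M₁ D₁ x a v e) (hp : Passes (M ∪ M₁) T e v f) (h' : K v f g w) :
    Segmented K M D N M₁ D₁ x a w g := by
  by_cases hp' : Passes M D e v f
  · obtain ⟨u, h, hu, hpre, W⟩ := hs
    exact ⟨u, h, hu, hpre, W.snoc hp' h'⟩
  by_cases hv : v ∈ N
  · have hvM := hS.notMem_of_mem hv
    have hvT : v ∈ T → v ∈ D₁ := fun h => hS.inter_subset ⟨h, hv⟩
    refine ⟨v, f, hv, Segmented.land hS hx hs hv ?_ ?_, .single h'⟩ <;>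
      cases e <;> cases f <;> simp_all
  · have hvM : v ∈ M₁ → v ∈ N := fun h => hS.subset_nodes h
    obtain ⟨rfl, rfl, hvT, hvD⟩ : e = true ∧ f = true ∧ v ∈ T ∧ v ∉ D := by
      cases e <;> cases f <;> simp_all
    obtain ⟨hvM, t, ht, htD₁, htD, h₁⟩ := hS.detour hvT hvD hv
    obtain ⟨u, h, hu, hpre, W⟩ := hs
    exact ⟨t, true, ht,
      Segmented.land hS hx ⟨u, h, hu, hpre, W.snoc (f := false) (by simpa using hvM) h₁⟩ ht htD₁
        (.inr htD),
      (Walk.single (hS.proper.symm h₁)).snoc (by simpa using hvM) h'⟩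

lemma walk_convert (hS : K.Splitting M D N M₁ D₁ T le) (hxN : x ∈ N) (hyN : y ∈ N)
    (hx : x ∉ M₁) (hy : y ∉ M₁) (hxy : x ≠ y) (W : Walk K (M ∪ M₁) T x a y b) :
    Walk (K.restrict N) M₁ D₁ x a y b := by
  have key : ∀ {v e}, Walk K (M ∪ M₁) T x a v e → Segmented K M D N M₁ D₁ x a v e := by
    intro v e W
    induction W with
    | single h => exact ⟨x, a, hxN, .inl ⟨rfl, rfl⟩, .single h⟩
    | snoc _ hp h ih => exact Segmented.snoc hS hx ih hp h
  obtain ⟨u, h, hu, hpre, W⟩ := key W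
  by_cases huy : u = y
  · subst huy
    rcases hpre with ⟨rfl, rfl⟩ | ⟨e₁, W₁, hp₁, huD⟩
    · exact absurd rfl hxy
    obtain ⟨rfl, rfl, -⟩ := hp₁.collider hy
    cases b
    · have huD := huD.resolve_left hy
      rcases hS.mem_or_le_of_walk_end W rfl with h | ⟨-, h⟩
      · exact absurd h huD
      · exact absurd (hS.mem_of_cycle h) huD
    · exact W₁
  · have W' := hS.walk_restrict hu hyN huy W
    rcases hpre with ⟨rfl, rfl⟩ | ⟨e₁, W₁, hp₁, -⟩
    · exact W'
    · exact W₁.append hp₁ W'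

lemma behead (hS : K.Splitting M D N M₁ D₁ T le) (hx : x ∈ D) (hy : y ∈ D) :
    (K.behead x y).Splitting M D N M₁ D₁ T le where
  toAnterior := hS.toAnterior.mono (hS.proper.behead x y) fun _ _ _ _ h => h.1
  closed _ _ _ _ _ _ _ hne h₁ h₂ hp := ⟨hS.closed hne h₁.1 h₂.1 hp, h₁.2.1, h₂.2.2⟩
  notMem_of_mem := hS.notMem_of_mem
  subset_nodes := hS.subset_nodes
  subset := hS.subset
  inter_subset := hS.inter_subset
  detour v hvT hvD hvN := by
    obtain ⟨hvM, u, hu, huD₁, huD, h⟩ := hS.detour hvT hvD hvN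
    refine ⟨hvM, u, hu, huD₁, huD, h, fun _ => rfl, ?_⟩
    rintro (rfl | rfl) <;> contradiction

lemma gen (hS : K.Splitting M D N M₁ D₁ T le) (hxN : x ∈ N) (hyN : y ∈ N) (hx : x ∉ M₁)
    (hy : y ∉ M₁) (h : Gen K (M ∪ M₁) T x a b y) : Gen (K.restrict N) M₁ D₁ x a b y := by
  have hxy := (Gen.proper hS.proper _ _).ne h
  refine Gen.transfer hS.proper hxy (by simp [hS.notMem_of_mem hxN, hx])
    (by simp [hS.notMem_of_mem hyN, hy]) hx hy hxN hyN
    (fun a b W => .inl (hS.walk_convert hxN hyN hx hy hxy W)) ?_ h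
  rintro ⟨h₁, -, h₃⟩
  have hxD := hS.mem_of_arrows h₁ h₃
  have hyD := hS.mem_of_arrows (hS.proper.symm h₃) (hS.proper.symm h₁)
  exact ⟨hS.closed.bridged hxD, hS.closed.bridged hyD,
    (hS.behead hxD hyD).walk_convert hxN hyN hx hy hxy⟩

end EdgeRel.Splitting

end Splitting

/-! ### The edge relation of a mixed graph -/

namespace MixedGraph

/-- The edges of a mixed graph, with the marks at both ends. -/
def edge (G : MixedGraph V) : EdgeRel V
  | u, false, false, v => G.line u v
  | u, false, true, v => G.arrow u v
  | u, true, false, v => G.arrow v u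
  | u, true, true, v => G.arc u v

/-- The graph with all generated edges and no deleted nodes. -/
def generated (G : MixedGraph V) (M S : Set V) : MixedGraph V :=
  ⟨G.nodes, GenArrow G M S, GenArc G M S, GenLine G M S⟩

variable {G G' : MixedGraph V} {M S C : Set V} {u v : V} {a b : Bool}

lemma ext_edge (hn : G.nodes = G'.nodes) (he : G.edge = G'.edge) : G = G' := by
  obtain ⟨n, r, c, l⟩ := G
  obtain ⟨n', r', c', l'⟩ := G'
  have h : ∀ a b u v, edge ⟨n, r, c, l⟩ u a b v = edge ⟨n', r', c', l'⟩ u a b v := by simp [he]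
  have hl : l = l' := by funext u v; exact h false false u v
  have hr : r = r' := by funext u v; exact h false true u v
  have hc : c = c' := by funext u v; exact h true true u v
  subst hl hr hc
  cases hn
  rfl

lemma IsLMG.proper (hG : G.IsLMG) : G.edge.Proper where
  symm {u a b v} h := by
    cases a <;> cases b
    · exact hG.1.2.1 _ _ h
    · exact h
    · exact h
    · exact hG.1.1 _ _ h
  ne {u a b v} h := by
    rintro rfl
    have := hG.2.1 u
    cases a <;> cases b <;> simp_all [edge]

lemma IsLMG.left_mem (hG : G.IsLMG) (h : G.edge u a b v) : u ∈ G.nodes := by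
  cases a <;> cases b
  · exact (hG.1.2.2 _ _ (.inr (.inr h))).1
  · exact (hG.1.2.2 _ _ (.inl h)).1
  · exact (hG.1.2.2 _ _ (.inl h)).2
  · exact (hG.1.2.2 _ _ (.inr (.inl h))).1

lemma IsLMG.right_mem (hG : G.IsLMG) (h : G.edge u a b v) : v ∈ G.nodes :=
  hG.left_mem (hG.proper.symm h)

mutual

private theorem gen_of_genArrow (hG : G.edge.Proper) {u v : V} :
    GenArrow G M S u v → Gen G.edge M S u false true v
  | .base h => .base h
  | .row1 hm hne h₁ h₂ =>
    .step hne (gen_of_genArrow hG h₁) (f := false) (gen_of_genArrow hG h₂) hm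
  | .row2 hm hne h₁ h₂ =>
    .step hne (gen_of_genLine hG h₁) (gen_of_genArrow hG h₂) hm
  | .row3 hm hne h₁ h₂ => .step hne (gen_of_genLine hG h₁) (gen_of_genArc hG h₂) hm
  | .row8 hs hne h₁ h₂ => .step hne (gen_of_genArrow hG h₁) (gen_of_genArc hG h₂) hs

private theorem gen_of_genArc (hG : G.edge.Proper) {u v : V} :
    GenArc G M S u v → Gen G.edge M S u true true v
  | .base h => .base h
  | .symm h => (Gen.proper hG M S).symm (gen_of_genArc hG h)
  | .row4 hm hne h₁ h₂ =>
    .step hne ((Gen.proper hG M S).symm (gen_of_genArrow hG h₁)) (gen_of_genArrow hG h₂) hm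
  | .row5 hm hne h₁ h₂ =>
    .step hne ((Gen.proper hG M S).symm (gen_of_genArrow hG h₁)) (gen_of_genArc hG h₂) hm
  | .row9 hs hne h₁ h₂ => .step hne (gen_of_genArc hG h₁) (gen_of_genArc hG h₂) hs

private theorem gen_of_genLine (hG : G.edge.Proper) {u v : V} :
    GenLine G M S u v → Gen G.edge M S u false false v
  | .base h => .base h
  | .symm h => (Gen.proper hG M S).symm (gen_of_genLine hG h)
  | .row6 hm hne h₁ h₂ =>
    .step hne (gen_of_genLine hG h₁) ((Gen.proper hG M S).symm (gen_of_genArrow hG h₂)) hm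
  | .row7 hm hne h₁ h₂ => .step hne (gen_of_genLine hG h₁) (gen_of_genLine hG h₂) hm
  | .row10 hs hne h₁ h₂ =>
    .step hne (gen_of_genArrow hG h₁) ((Gen.proper hG M S).symm (gen_of_genArrow hG h₂)) hs

end

private lemma edge_generated_of_gen (h : Gen G.edge M S u a b v) :
    (G.generated M S).edge u a b v := by
  induction h with
  | @base u v a b h => cases a <;> cases b <;> exact .base h
  | @step u m v a e f b hne _ _ hp h₁ h₂ =>
    cases a <;> cases e <;> cases f <;> cases b
    · exact .row7 hp hne h₁ h₂
    · exact .row2 hp hne h₁ h₂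
    · exact .row6 hp hne h₁ h₂
    · exact .row3 hp hne h₁ h₂
    · exact .symm (.row6 hp hne.symm (.symm h₂) h₁)
    · exact .row1 hp hne h₁ h₂
    · exact .row10 hp hne h₁ h₂
    · exact .row8 hp hne h₁ h₂
    · exact .row2 hp hne.symm (.symm h₂) h₁
    · exact .row4 hp hne h₁ h₂
    · exact .row1 hp hne.symm h₂ h₁
    · exact .row5 hp hne h₁ h₂
    · exact .row3 hp hne.symm (.symm h₂) (.symm h₁)
    · exact .symm (.row5 hp hne.symm h₂ (.symm h₁))
    · exact .row8 hp hne.symm h₂ (.symm h₁)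
    · exact .row9 hp hne h₁ h₂

lemma edge_generated (hG : G.edge.Proper) : (G.generated M S).edge = Gen G.edge M S := by
  funext u a b v
  refine propext ⟨fun h => ?_, edge_generated_of_gen⟩
  cases a <;> cases b
  · exact gen_of_genLine hG h
  · exact gen_of_genArrow hG h
  · exact (Gen.proper hG M S).symm (gen_of_genArrow hG h)
  · exact gen_of_genArc hG h

lemma edge_alphaRG (hG : G.edge.Proper) : (alphaRG G M C).edge =
    (Gen G.edge M (C ∪ G.anSet C)).restrict (G.nodes \ (M ∪ C)) := by
  rw [← edge_generated hG]
  funext u a b v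
  cases a <;> cases b <;> simp only [edge, alphaRG, generated, EdgeRel.restrict] <;>
    exact propext (by tauto)

lemma IsRG.bridged (hG : G.IsRG) (hv : G.RibbonTail v) : G.edge.Bridged v := by
  intro u w h g hne h₁ h₂
  have hP := hG.1.proper
  have huv := hP.ne h₁
  have hvw := hP.ne h₂
  by_contra hn
  refine hG.2 ?_
  cases h <;> cases g
  · exact ⟨u, v, w, huv, hvw, hne, hv, .inr (.inl ⟨h₁, h₂, hn⟩)⟩
  · exact ⟨u, v, w, huv, hvw, hne, hv, .inr (.inr ⟨h₁, h₂, hn⟩)⟩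
  · exact ⟨w, v, u, hvw.symm, huv.symm, hne.symm, hv, .inr (.inr ⟨h₂, hP.symm h₁, hn⟩)⟩
  · exact ⟨u, v, w, huv, hvw, hne, hv, .inl ⟨h₁, h₂, hn⟩⟩

lemma RibbonTail.of_anc (h : G.anc u v) (hv : G.RibbonTail v) : G.RibbonTail u := by
  obtain ⟨d, rfl | hd, h'⟩ := hv
  · exact ⟨d, .inr h, h'⟩
  · exact ⟨d, .inr (h.trans hd), h'⟩

lemma mem_of_anc (h : G.anc u v) (hv : v ∈ C ∪ G.anSet C) : u ∈ C ∪ G.anSet C := by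
  rcases hv with hv | ⟨c, hc, hv⟩
  · exact .inr ⟨v, hv, h⟩
  · exact .inr ⟨c, hc, h.trans hv⟩

/-- The nodes in or above `C` together with those that may be the inner node of a ribbon. -/
def bridgedSet (G : MixedGraph V) (C : Set V) : Set V :=
  (C ∪ G.anSet C) ∪ {v | G.RibbonTail v}

lemma anterior (hG : G.IsLMG) (C : Set V) : G.edge.Anterior (G.bridgedSet C) G.anc where
  proper := hG.proper
  trans _ _ _ h₁ h₂ := h₁.trans h₂
  mem_of_le _ _ h := Or.imp (mem_of_anc h) (RibbonTail.of_anc h)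
  mem_of_cycle u h := .inr ⟨u, .inl rfl, .inr h⟩
  tail u v b h := by
    cases b
    · exact .inl (.inr ⟨u, .inl rfl, .inl ⟨v, h⟩⟩)
    · exact .inr ⟨rfl, .single h⟩

/-- In a ribbonless graph, potential inner nodes of ribbons need not be admitted as colliders. -/
lemma IsRG.gen_prune (hG : G.IsRG) (hu : u ∉ M) (hv : v ∉ M)
    (h : Gen G.edge M (S ∪ {v | G.RibbonTail v}) u a b v) : Gen G.edge M S u a b v :=
  h.prune hG.1.proper (fun _ _ h hv => RibbonTail.of_anc (.single h) hv) (fun _ hv => hG.bridged hv)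
    (fun u _ h₁ h₂ => ⟨u, .inl rfl, .inr (.tail (.single h₁) h₂)⟩) hu hv

lemma IsRG.edge_alphaRG (hG : G.IsRG) : (alphaRG G M C).edge =
    (Gen G.edge M (G.bridgedSet C)).restrict (G.nodes \ (M ∪ C)) := by
  rw [MixedGraph.edge_alphaRG hG.1.proper]
  funext u a b v
  refine propext ⟨fun h => ⟨h.1.mono (fun _ _ _ _ => id) le_rfl Set.subset_union_left, h.2⟩,
    fun h => ⟨hG.gen_prune (fun h' => h.2.1.2 (.inl h')) (fun h' => h.2.2.2 (.inl h')) h.1, h.2⟩⟩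

lemma IsRG.arrow_alphaRG_iff (hG : G.IsRG) : (alphaRG G M C).arrow u v ↔
    Gen G.edge M (G.bridgedSet C) u false true v ∧ u ∈ G.nodes \ (M ∪ C) ∧
      v ∈ G.nodes \ (M ∪ C) := by
  change (alphaRG G M C).edge u false true v ↔ _
  rw [hG.edge_alphaRG]
  rfl

variable {M₁ C₁ : Set V} {c : V}

/-- A node above `C₁` but not bridged is a parent of a node that survives `alphaRG G M C`. -/
lemma IsRG.exists_arrow_of_anc (hG : G.IsRG) (hC₁ : C₁ ⊆ G.nodes) (hMC₁ : Disjoint M C₁)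
    (hCC₁ : Disjoint C C₁) (hc : c ∈ C₁) (h : G.anc v c) (hv : v ∉ G.bridgedSet C) :
    ∃ u ∈ G.nodes \ (M ∪ C), u ∈ C₁ ∪ (alphaRG G M C).anSet C₁ ∧ u ∉ G.bridgedSet C ∧
      Gen G.edge M (G.bridgedSet C) v false true u := by
  have hA := anterior hG.1 C
  induction h using Relation.TransGen.head_induction_on with
  | @single v h =>
    exact ⟨c, ⟨hC₁ hc, not_or.2 ⟨fun h => hMC₁.le_bot ⟨h, hc⟩, fun h => hCC₁.le_bot ⟨h, hc⟩⟩⟩,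
      .inl hc, fun h' => hv (hA.mem_of_arrow h h'), .base h⟩
  | @head v w h hwc ih =>
    have hw : w ∉ G.bridgedSet C := fun h' => hv (hA.mem_of_arrow h h')
    obtain ⟨u, hu, hu₁, huD, h'⟩ := ih hw
    have hwn : w ∈ G.nodes := hG.1.right_mem (a := false) (b := true) h
    by_cases hwM : w ∈ M
    · have hvu : v ≠ u := by
        rintro rfl
        rcases (hA.gen M).tail h' with h' | ⟨-, h'⟩
        · exact hw h'
        · exact hv (hA.mem_of_cycle (.head h h'))
      exact ⟨u, hu, hu₁, huD, .step (e := true) (f := false) hvu (.base h) h' hwM⟩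
    · have hwN : w ∈ G.nodes \ (M ∪ C) := ⟨hwn, not_or.2 ⟨hwM, fun h => hw (.inl (.inl h))⟩⟩
      exact ⟨w, hwN, mem_of_anc (.single (hG.arrow_alphaRG_iff.2 ⟨h', hwN, hu⟩)) hu₁, hw, .base h⟩

lemma bridgedSet_mono {C' : Set V} (h : C ⊆ C') : G.bridgedSet C ⊆ G.bridgedSet C' :=
  Set.union_subset_union_left _ (Set.union_subset_union h fun _ ⟨c, hc, h'⟩ => ⟨c, h hc, h'⟩)

lemma IsRG.anSet_alphaRG_subset (hG : G.IsRG) :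
    C₁ ∪ (alphaRG G M C).anSet C₁ ⊆ G.bridgedSet (C ∪ C₁) := by
  have hC₁ : C₁ ⊆ G.bridgedSet (C ∪ C₁) := fun c hc => .inl (.inl (.inr hc))
  have step : ∀ ⦃v w⦄, (alphaRG G M C).arrow v w → w ∈ G.bridgedSet (C ∪ C₁) →
      v ∈ G.bridgedSet (C ∪ C₁) := by
    intro v w h
    exact ((anterior hG.1 _).gen M).mem_of_arrow ((hG.arrow_alphaRG_iff.1 h).1.mono
      (fun _ _ _ _ => id) le_rfl (bridgedSet_mono Set.subset_union_left))
  rintro v (hv | ⟨c, hc, h⟩)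
  · exact hC₁ hv
  induction h using Relation.TransGen.head_induction_on with
  | single h => exact step h (hC₁ hc)
  | head h _ ih => exact step h ih

/-- Generation in two steps creates no more edges than generation in one step. -/
lemma IsRG.gen_of_gen_alphaRG (hG : G.IsRG) (hu : u ∉ M ∪ M₁) (hv : v ∉ M ∪ M₁)
    (h : Gen (alphaRG G M C).edge M₁ (C₁ ∪ (alphaRG G M C).anSet C₁) u a b v) :
    Gen G.edge (M ∪ M₁) ((C ∪ C₁) ∪ G.anSet (C ∪ C₁)) u a b v := by
  refine hG.gen_prune hu hv (Gen.of_closed (Gen.closed _ _ _) (h.mono ?_ Set.subset_union_right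
    hG.anSet_alphaRG_subset))
  rw [hG.edge_alphaRG]
  exact fun _ _ _ _ h => h.1.mono (fun _ _ _ _ => id) Set.subset_union_left
    (bridgedSet_mono Set.subset_union_left)

/-- Generation in one step creates no more edges than generation in two steps. -/
lemma IsRG.gen_alphaRG_of_gen (hG : G.IsRG) (hM₁ : M₁ ⊆ G.nodes) (hC₁ : C₁ ⊆ G.nodes)
    (hMM₁ : Disjoint M M₁) (hMC₁ : Disjoint M C₁) (hCM₁ : Disjoint C M₁) (hCC₁ : Disjoint C C₁)
    (hu : u ∈ G.nodes \ (M ∪ C)) (hv : v ∈ G.nodes \ (M ∪ C)) (hu₁ : u ∉ M₁) (hv₁ : v ∉ M₁)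
    (h : Gen G.edge (M ∪ M₁) ((C ∪ C₁) ∪ G.anSet (C ∪ C₁)) u a b v) :
    Gen (alphaRG G M C).edge M₁ (C₁ ∪ (alphaRG G M C).anSet C₁) u a b v := by
  have hA := (anterior hG.1 C).gen M
  have hbr : ∀ v ∈ G.bridgedSet C, (Gen G.edge M (G.bridgedSet C)).Bridged v :=
    fun v hv => (Gen.closed _ _ _).bridged hv
  have hP := hA.proper.restrict (G.nodes \ (M ∪ C))
  have hA' := hA.mono hP fun _ _ _ _ h => h.1
  rw [hG.edge_alphaRG]
  refine Gen.prune (D := G.bridgedSet C) hP (fun _ _ => hA'.mem_of_arrow)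
    (fun v hv u w h g hne h₁ h₂ => ⟨hbr v hv hne h₁.1 h₂.1, h₁.2.1, h₂.2.2⟩)
    (fun _ _ => hA'.mem_of_arrows) hu₁ hv₁ ?_
  have key : ∀ v ∈ (C ∪ C₁) ∪ G.anSet (C ∪ C₁), v ∉ G.bridgedSet C → v ∈ C₁ ∨
      v ∈ G.nodes ∧ ∃ u ∈ G.nodes \ (M ∪ C), u ∈ C₁ ∪ (alphaRG G M C).anSet C₁ ∧
        u ∉ G.bridgedSet C ∧ Gen G.edge M (G.bridgedSet C) v false true u := by
    rintro v ((hv | hv) | ⟨c, hc | hc, h⟩) hvD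
    · exact absurd (.inl (.inl hv)) hvD
    · exact .inl hv
    · exact absurd (.inl (.inr ⟨c, hc, h⟩)) hvD
    · obtain ⟨w, hvw, -⟩ := Relation.TransGen.head'_iff.1 h
      exact .inr ⟨hG.1.left_mem (a := false) (b := true) hvw,
        hG.exists_arrow_of_anc hC₁ hMC₁ hCC₁ hc h hvD⟩
  have hS : EdgeRel.Splitting (Gen G.edge M (G.bridgedSet C)) M (G.bridgedSet C)
      (G.nodes \ (M ∪ C)) M₁ ((C₁ ∪ (alphaRG G M C).anSet C₁) ∪ G.bridgedSet C)
      ((C ∪ C₁) ∪ G.anSet (C ∪ C₁)) G.anc :=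
    { toAnterior := hA
      closed := Gen.closed _ _ _
      notMem_of_mem := fun v hv h => hv.2 (.inl h)
      subset_nodes := fun v hv => ⟨hM₁ hv, not_or.2
        ⟨fun h => hMM₁.le_bot ⟨h, hv⟩, fun h => hCM₁.le_bot ⟨h, hv⟩⟩⟩
      subset := Set.subset_union_right
      inter_subset := by
        rintro v ⟨hv, hvN⟩
        by_cases hvD : v ∈ G.bridgedSet C
        · exact .inr hvD
        rcases key v hv hvD with hv | ⟨-, u, huN, hu, -, h⟩
        · exact .inl (.inl hv)
        · exact .inl (mem_of_anc (.single (hG.arrow_alphaRG_iff.2 ⟨h, hvN, huN⟩)) hu)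
      detour := by
        intro v hv hvD hvN
        rcases key v hv hvD with hv | ⟨hvn, u, huN, hu, huD, h⟩
        · exact absurd ⟨hC₁ hv, not_or.2
            ⟨fun h => hMC₁.le_bot ⟨h, hv⟩, fun h => hCC₁.le_bot ⟨h, hv⟩⟩⟩ hvN
        · refine ⟨?_, u, huN, .inl hu, huD, h⟩
          by_contra hvM
          exact hvN ⟨hvn, not_or.2 ⟨hvM, fun h => hvD (.inl (.inl h))⟩⟩ }
  exact hS.gen hu hv hu₁ hv₁ (h.mono (fun _ _ _ _ h => .base h) le_rfl le_rfl)

end MixedGraph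

/-- (Theorem 1) `α_RG` is well-defined with respect to
splitting the marginalisation and conditioning sets: for a ribbonless graph
`H` and pairwise disjoint subsets `C`, `C₁`, `M`, `M₁` of its node set,
`α_RG(α_RG(H;M,C);M₁,C₁) = α_RG(H;M∪M₁,C∪C₁)`. -/
theorem stmt_3 {V : Type} (H : MixedGraph V) (M C M₁ C₁ : Set V)
    (hH : H.IsRG)
    (hM : M ⊆ H.nodes) (hC : C ⊆ H.nodes)
    (hM₁ : M₁ ⊆ H.nodes) (hC₁ : C₁ ⊆ H.nodes)
    (hMC : Disjoint M C) (hMM₁ : Disjoint M M₁) (hMC₁ : Disjoint M C₁)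
    (hCM₁ : Disjoint C M₁) (hCC₁ : Disjoint C C₁) (hM₁C₁ : Disjoint M₁ C₁) :
    alphaRG (alphaRG H M C) M₁ C₁ = alphaRG H (M ∪ M₁) (C ∪ C₁) := by
  have hE : (alphaRG H M C).edge.Proper := by
    rw [MixedGraph.edge_alphaRG hH.1.proper]
    exact (Gen.proper hH.1.proper _ _).restrict _
  have hN : (alphaRG H M C).nodes \ (M₁ ∪ C₁) = H.nodes \ ((M ∪ M₁) ∪ (C ∪ C₁)) := by
    change (H.nodes \ (M ∪ C)) \ (M₁ ∪ C₁) = _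
    rw [Set.sdiff_sdiff, Set.union_union_union_comm]
  refine MixedGraph.ext_edge hN ?_
  rw [MixedGraph.edge_alphaRG hE, MixedGraph.edge_alphaRG (M := M ∪ M₁) hH.1.proper, hN]
  funext u a b v
  refine propext ⟨fun h => ⟨?_, h.2⟩, fun h => ⟨?_, h.2⟩⟩
  · exact hH.gen_of_gen_alphaRG (fun h' => h.2.1.2 (.inl h')) (fun h' => h.2.2.2 (.inl h')) h.1
  · obtain ⟨h, hu, hv⟩ := h
    rw [← hN] at hu hv
    exact hH.gen_alphaRG_of_gen hM₁ hC₁ hMM₁ hMC₁ hCM₁ hCC₁ hu.1 hv.1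
      (fun h' => hu.2 (.inl h')) (fun h' => hv.2 (.inl h')) h

end StableMixedGraphs
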